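/- (Theorem 2.) Let k₋ < k₊ satisfy 2A ≤ k₊ − k₋, let γ satisfy (k₋ + A)(1 − (1−λ)^Δ) ≤ γ ≤ (k₊ − A)(1 − (1−λ)^Δ), and let k₀ ≥ 0 satisfy μ/(μ²k₀² + 1) < b. Assume in addition that |f^j(x)| ≥ k₀ for every x ∈ [k₋, k₊] and every j ∈ {0, 1, …, Δ−1}. Then F has a unique fixed point x* in [k₋, k₊] (hence the impulsed system has a unique Δ-periodic orbit starting in [k₋, k₊]), and this fixed point is exponentially stable with convergence rate factor ρ = (1 − λ + λμ/(b(μ²k₀² + 1)))^Δ < 1: for every x ∈ [k₋, k₊] and every i ∈ ℕ, |F^i(x) − x*| ≤ ρ^i · |x − x*|. -/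

import Mathlib

/-- If every iterate `f^[j]` with `j < n` maps `[p, q]` into a set on whose subsegments the
continuous map `f` is `L`-Lipschitz, then `f^[n]` is `L ^ n`-Lipschitz on `[p, q]`. -/
theorem abs_iterate_sub_iterate_le {f : ℝ → ℝ} {L p q : ℝ} {S : Set ℝ} {n : ℕ}
    (hL : 0 ≤ L) (hcont : Continuous f)
    (hlip : ∀ u v : ℝ, Set.uIcc u v ⊆ S → |f u - f v| ≤ L * |u - v|)
    (hS : ∀ x ∈ Set.Icc p q, ∀ j < n, f^[j] x ∈ S)
    {x y : ℝ} (hx : x ∈ Set.Icc p q) (hy : y ∈ Set.Icc p q) :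
    |f^[n] x - f^[n] y| ≤ L ^ n * |x - y| := by
  induction n with
  | zero => simp
  | succ n ih =>
    have hsub : Set.uIcc (f^[n] x) (f^[n] y) ⊆ S := by
      refine (intermediate_value_uIcc (hcont.iterate n).continuousOn).trans ?_
      rintro _ ⟨z, hz, rfl⟩
      exact hS z (Set.uIcc_subset_Icc hx hy hz) n n.lt_succ_self
    have hn := ih fun z hz j hj => hS z hz j (hj.trans n.lt_succ_self)
    rw [Function.iterate_succ_apply', Function.iterate_succ_apply']
    calc |f (f^[n] x) - f (f^[n] y)| ≤ L * |f^[n] x - f^[n] y| := hlip _ _ hsub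
      _ ≤ L * (L ^ n * |x - y|) := by gcongr
      _ = L ^ (n + 1) * |x - y| := by ring

/-- Iterates of a perturbation of `y ↦ c * y` of size at most `(1 - c) * A` stay within
`A * (1 - c ^ n)` of the unperturbed ones. -/
theorem abs_iterate_sub_pow_mul_le {f : ℝ → ℝ} {c A : ℝ} (hc : 0 ≤ c)
    (hf : ∀ y, |f y - c * y| ≤ (1 - c) * A) (n : ℕ) (x : ℝ) :
    |f^[n] x - c ^ n * x| ≤ A * (1 - c ^ n) := by
  induction n with
  | zero => simp
  | succ n ih =>
    rw [Function.iterate_succ_apply']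
    calc |f (f^[n] x) - c ^ (n + 1) * x|
        = |(f (f^[n] x) - c * f^[n] x) + c * (f^[n] x - c ^ n * x)| := by congr 1; ring
      _ ≤ |f (f^[n] x) - c * f^[n] x| + |c * (f^[n] x - c ^ n * x)| := abs_add_le _ _
      _ = |f (f^[n] x) - c * f^[n] x| + c * |f^[n] x - c ^ n * x| := by
          rw [abs_mul, abs_of_nonneg hc]
      _ ≤ (1 - c) * A + c * (A * (1 - c ^ n)) := by gcongr; exact hf _
      _ = A * (1 - c ^ (n + 1)) := by ring

/-- The derivative of the supply–demand map. -/
theorem hasDerivAt_supplyDemand (a b μ lam y : ℝ) :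
    HasDerivAt
      (fun y : ℝ => (1 - lam) * y + (a / b) * lam - (lam / b) * Real.arctan (μ * y))
      ((1 - lam) - (lam / b) * (1 / (1 + (μ * y) ^ 2) * μ)) y := by
  have h₁ : HasDerivAt (fun y : ℝ => μ * y) μ y := by
    simpa using (hasDerivAt_id y).const_mul μ
  have h₂ : HasDerivAt (fun y : ℝ => (1 - lam) * y) (1 - lam) y := by
    simpa using (hasDerivAt_id y).const_mul (1 - lam)
  exact (h₂.add_const _).sub (h₁.arctan.const_mul (lam / b))

/-- Away from the origin, the derivative of the supply–demand map is small. -/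
theorem abs_deriv_supplyDemand_le {b μ lam k₀ y : ℝ} (hb : 0 < b) (hμ : 0 < μ)
    (hlam : 0 < lam) (hlam1 : lam < 1) (hk₀ : 0 ≤ k₀) (hy : k₀ ≤ |y|) :
    |(1 - lam) - (lam / b) * (1 / (1 + (μ * y) ^ 2) * μ)| ≤
      1 - lam + lam * μ / (b * (μ ^ 2 * k₀ ^ 2 + 1)) := by
  have hsq : k₀ ^ 2 ≤ y ^ 2 := by
    rw [← sq_abs y]
    gcongr
  have hle : (lam / b) * (1 / (1 + (μ * y) ^ 2) * μ) ≤
      lam * μ / (b * (μ ^ 2 * k₀ ^ 2 + 1)) := by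
    calc (lam / b) * (1 / (1 + (μ * y) ^ 2) * μ)
        = lam * μ / (b * (μ ^ 2 * y ^ 2 + 1)) := by field_simp; ring
      _ ≤ lam * μ / (b * (μ ^ 2 * k₀ ^ 2 + 1)) := by gcongr
  have hnonneg : 0 ≤ (lam / b) * (1 / (1 + (μ * y) ^ 2) * μ) := by positivity
  rw [abs_le]
  constructor <;> linarith

/-- The supply–demand map differs from its linear part by at most `lam * A`. -/
theorem abs_supplyDemand_sub_le {a b lam : ℝ} (hb : 0 < b) (hlam : 0 < lam) (t : ℝ) :
    |(a / b) * lam - (lam / b) * Real.arctan t| ≤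
      lam * (|a| / b + Real.pi / (2 * b)) := by
  have harctan : |Real.arctan t| ≤ Real.pi / 2 :=
    abs_le.2 ⟨by linarith [Real.neg_pi_div_two_lt_arctan t],
      (Real.arctan_lt_pi_div_two t).le⟩
  calc |(a / b) * lam - (lam / b) * Real.arctan t|
      = lam / b * |a - Real.arctan t| := by
        rw [← abs_of_pos (div_pos hlam hb), ← abs_mul, abs_of_pos (div_pos hlam hb)]
        congr 1
        ring
    _ ≤ lam / b * (|a| + Real.pi / 2) := by
        gcongr
        exact (abs_sub _ _).trans (by gcongr)
    _ = lam * (|a| / b + Real.pi / (2 * b)) := by field_simp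


/-- Theorem 2: under the window condition on `γ`, `2A ≤ k₊ − k₋`,
`μ/(μ²k₀²+1) < b`, and the assumption that all intermediate iterates of points of
`[k₋, k₊]` stay at distance `≥ k₀` from the origin, `F` has a unique fixed point
`x* ∈ [k₋, k₊]`, which is exponentially stable with rate
`ρ = (1 − λ + λμ/(b(μ²k₀²+1)))^Δ < 1` (here `km = k₋`, `kp = k₊`). -/
theorem unique_exponentially_stable_periodic_orbit
    (a b μ lam γ A : ℝ) (hb : 0 < b) (hμ : 0 < μ) (hlam : 0 < lam) (hlam1 : lam < 1)
    (f : ℝ → ℝ)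
    (hf : ∀ y : ℝ, f y = (1 - lam) * y + (a / b) * lam - (lam / b) * Real.arctan (μ * y))
    (hA : A = |a| / b + Real.pi / (2 * b))
    (Δ : ℕ) (hΔ : 1 ≤ Δ)
    (F : ℝ → ℝ) (hF : ∀ y : ℝ, F y = f^[Δ] y + γ)
    (km kp : ℝ) (hk : km < kp) (h2A : 2 * A ≤ kp - km)
    (hγ₁ : (km + A) * (1 - (1 - lam) ^ Δ) ≤ γ)
    (hγ₂ : γ ≤ (kp - A) * (1 - (1 - lam) ^ Δ))
    (k₀ : ℝ) (hk₀ : 0 ≤ k₀) (hμb : μ / (μ ^ 2 * k₀ ^ 2 + 1) < b)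
    (hiter : ∀ x ∈ Set.Icc km kp, ∀ j : ℕ, j < Δ → k₀ ≤ |f^[j] x|) :
    ∃ xs ∈ Set.Icc km kp, F xs = xs ∧
      (∀ y ∈ Set.Icc km kp, F y = y → y = xs) ∧
      (1 - lam + lam * μ / (b * (μ ^ 2 * k₀ ^ 2 + 1))) ^ Δ < 1 ∧
      ∀ x ∈ Set.Icc km kp, ∀ i : ℕ,
        |F^[i] x - xs| ≤
          ((1 - lam + lam * μ / (b * (μ ^ 2 * k₀ ^ 2 + 1))) ^ Δ) ^ i * |x - xs| := by
  set L := 1 - lam + lam * μ / (b * (μ ^ 2 * k₀ ^ 2 + 1))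
  have hL0 : 0 ≤ L := by
    have : 0 ≤ lam * μ / (b * (μ ^ 2 * k₀ ^ 2 + 1)) := by positivity
    linarith
  have hL1 : L < 1 := by
    have h : lam * μ / (b * (μ ^ 2 * k₀ ^ 2 + 1)) < lam := by
      rw [div_lt_iff₀ (by positivity)]
      rw [div_lt_iff₀ (by positivity)] at hμb
      exact mul_lt_mul_of_pos_left hμb hlam
    linarith
  have hderiv : ∀ y, HasDerivAt f ((1 - lam) - (lam / b) * (1 / (1 + (μ * y) ^ 2) * μ)) y := by
    rw [funext hf]
    exact hasDerivAt_supplyDemand a b μ lam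
  have hcont : Continuous f := continuous_iff_continuousAt.2 fun y => (hderiv y).continuousAt
  have hlip : ∀ u v : ℝ, Set.uIcc u v ⊆ {y | k₀ ≤ |y|} → |f u - f v| ≤ L * |u - v| :=
    fun u v huv => (convex_uIcc u v).norm_image_sub_le_of_norm_hasDerivWithin_le
      (fun y _ => (hderiv y).hasDerivWithinAt)
      (fun y hy => abs_deriv_supplyDemand_le hb hμ hlam hlam1 hk₀ (huv hy))
      Set.right_mem_uIcc Set.left_mem_uIcc
  have hcontr : ∀ x ∈ Set.Icc km kp, ∀ y ∈ Set.Icc km kp,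
      |F x - F y| ≤ L ^ Δ * |x - y| := by
    intro x hx y hy
    rw [hF, hF, add_sub_add_right_eq_sub]
    exact abs_iterate_sub_iterate_le hL0 hcont hlip hiter hx hy
  have hmaps : Set.MapsTo F (Set.Icc km kp) (Set.Icc km kp) := by
    intro x hx
    have hc : 0 ≤ 1 - lam := by linarith
    have hdist := abs_le.1 (abs_iterate_sub_pow_mul_le (f := f) (A := A) hc (fun y => by
      rw [hf, hA, sub_sub_cancel, add_sub_assoc, add_sub_cancel_left]
      exact abs_supplyDemand_sub_le hb hlam (μ * y)) Δ x)
    have hq : 0 ≤ (1 - lam) ^ Δ := by positivity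
    have hlow := mul_le_mul_of_nonneg_left hx.1 hq
    have hupp := mul_le_mul_of_nonneg_left hx.2 hq
    rw [hF]
    constructor <;> linarith [hdist.1, hdist.2]
  have hρ1 : L ^ Δ < 1 := pow_lt_one₀ hL0 hL1 (by lia)
  have hFcont : Continuous F := by
    rw [funext hF]
    exact (hcont.iterate Δ).add_const γ
  obtain ⟨xs, hxs, hfix⟩ :=
    exists_mem_Icc_isFixedPt_of_mapsTo hFcont.continuousOn hk.le hmaps
  refine ⟨xs, hxs, hfix, fun y hy hyfix => ?_, hρ1, fun x hx i => ?_⟩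
  · have h := hcontr y hy xs hxs
    rw [hyfix, hfix.eq] at h
    have hzero : |y - xs| = 0 := by nlinarith [abs_nonneg (y - xs)]
    exact sub_eq_zero.1 (abs_eq_zero.1 hzero)
  · have h := abs_iterate_sub_iterate_le (f := F) (n := i) (S := Set.Icc km kp)
      (pow_nonneg hL0 Δ) hFcont
      (fun u v huv => hcontr u (huv Set.left_mem_uIcc) v (huv Set.right_mem_uIcc))
      (fun z hz j _ => hmaps.iterate j hz) hx hxs
    rwa [(hfix.iterate i).eq] at h
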